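/- arXiv:1304.1641 — 2 statements merged into one kernel-verified Lean document; each statement's English description precedes it below -/
import Mathlib

section
/- In the group B(3,N) with generators R_{abc} for 1 ≤ a < b < c ≤ N, where two generators commute unless their index sets share exactly two elements, and R_{abc}·R_{abd}·R_{acd}·R_{bcd} = R_{bcd}·R_{acd}·R_{abd}·R_{abc} for all a < b < c < d (tetrahedron relations), the lexicographically ordered product W(3,N) = ∏→_{1≤a<b<c≤N} R_{abc} equals the reversely ordered product ∏←_{1≤a<b<c≤N} R_{abc}. -/
/-- The list of triples `(a,b,c)` with `1 ≤ a < b < c ≤ N`, in lexicographic order. -/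
def tripleList (N : ℕ) : List (ℕ × ℕ × ℕ) :=
  (((List.range (N + 1)).flatMap fun a =>
      (List.range (N + 1)).flatMap fun b =>
        (List.range (N + 1)).map fun c => (a, b, c)).filter
    fun t => decide (1 ≤ t.1 ∧ t.1 < t.2.1 ∧ t.2.1 < t.2.2 ∧ t.2.2 ≤ N))

namespace List

variable {α : Type*}

/-- The pairs `(a, b)` with `a` before `b` in the list, in lexicographic order of positions. -/
def pairs : List α → List (α × α)
  | [] => []
  | a :: l => l.map (fun b => (a, b)) ++ pairs l

/-- The triples `(a, b, c)` of entries in increasing positions of the list, in lexicographic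
order of positions. -/
def triples : List α → List (α × α × α)
  | [] => []
  | a :: l => l.pairs.map (fun p => (a, p)) ++ triples l

theorem mem_pairs_iff [LinearOrder α] {l : List α} (hl : l.Pairwise (· < ·)) {a b : α} :
    (a, b) ∈ l.pairs ↔ a ∈ l ∧ b ∈ l ∧ a < b := by
  induction l with
  | nil => simp [pairs]
  | cons x l ih =>
    rw [pairwise_cons] at hl
    have ih := ih hl.2
    have hx := hl.1
    simp only [pairs, mem_append, mem_map, Prod.mk.injEq, mem_cons, ih]
    constructor
    · grind
    · rintro ⟨rfl | ha, rfl | hb, hab⟩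
      · exact absurd hab (lt_irrefl _)
      · exact Or.inl ⟨b, hb, rfl, rfl⟩
      · exact absurd hab (hx a ha).not_gt
      · exact Or.inr ⟨ha, hb, hab⟩

theorem mem_triples_iff [LinearOrder α] {l : List α} (hl : l.Pairwise (· < ·)) {a b c : α} :
    (a, b, c) ∈ l.triples ↔ a ∈ l ∧ b ∈ l ∧ c ∈ l ∧ a < b ∧ b < c := by
  induction l with
  | nil => simp [triples]
  | cons x l ih =>
    rw [pairwise_cons] at hl
    have ih := ih hl.2
    have hx := hl.1
    simp only [triples, mem_append, mem_map, Prod.mk.injEq, mem_cons, ih, Prod.exists,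
      mem_pairs_iff hl.2]
    constructor
    · grind
    · rintro ⟨rfl | ha, rfl | hb, rfl | hc, hab, hbc⟩ <;> grind

theorem pairwise_pairs [LinearOrder α] {l : List α} (hl : l.Pairwise (· < ·)) :
    l.pairs.Pairwise (Prod.Lex (· < ·) (· < ·)) := by
  induction l with
  | nil => simp [pairs]
  | cons x l ih =>
    rw [pairwise_cons] at hl
    rw [pairs, pairwise_append, pairwise_map]
    refine ⟨hl.2.imp fun h => .right _ h, ih hl.2, ?_⟩
    rintro p hp ⟨c, d⟩ hq
    obtain ⟨b, -, rfl⟩ := mem_map.1 hp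
    exact .left _ _ (hl.1 c ((mem_pairs_iff hl.2).1 hq).1)

theorem pairwise_triples [LinearOrder α] {l : List α} (hl : l.Pairwise (· < ·)) :
    l.triples.Pairwise (Prod.Lex (· < ·) (Prod.Lex (· < ·) (· < ·))) := by
  induction l with
  | nil => simp [triples]
  | cons x l ih =>
    rw [triples, pairwise_append, pairwise_map]
    rw [pairwise_cons] at hl
    refine ⟨(pairwise_pairs hl.2).imp fun h => .right _ h, ih hl.2, ?_⟩
    rintro p hp ⟨c, d, e⟩ hq
    obtain ⟨b, -, rfl⟩ := mem_map.1 hp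
    exact .left _ _ (hl.1 c ((mem_triples_iff hl.2).1 hq).1)

theorem nodup_pairs [LinearOrder α] {l : List α} (hl : l.Pairwise (· < ·)) : l.pairs.Nodup :=
  (pairwise_pairs hl).imp fun {p q} h => by
    rintro rfl
    simp [Prod.lex_def] at h

section Monoid

variable {M : Type*} [Monoid M]

theorem prod_map_mul_of_commute {l : List α} (hl : l.Nodup) {f g : α → M}
    (h : ∀ p ∈ l, ∀ q ∈ l, p ≠ q → Commute (g p) (f q)) :
    (l.map fun p => f p * g p).prod = (l.map f).prod * (l.map g).prod := by
  induction l with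
  | nil => simp
  | cons a l ih =>
    rw [nodup_cons] at hl
    have hc : Commute (g a) (l.map f).prod := Commute.list_prod_right _ _ fun y hy => by
      obtain ⟨q, hq, rfl⟩ := mem_map.1 hy
      exact h a mem_cons_self q (mem_cons_of_mem _ hq) fun e => hl.1 (e ▸ hq)
    simp only [map_cons, prod_cons,
      ih hl.2 fun p hp q hq => h p (mem_cons_of_mem _ hp) q (mem_cons_of_mem _ hq)]
    simp only [mul_assoc, hc.left_comm]

theorem commute_prod_map {l : List α} {f : α → M} {x : M} (h : ∀ a ∈ l, Commute x (f a)) :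
    Commute x (l.map f).prod :=
  Commute.list_prod_right _ _ fun y hy => by
    obtain ⟨a, ha, rfl⟩ := mem_map.1 hy
    exact h a ha

theorem mul_prod_map_mul_prod_map {l : List α} (hl : l.Nodup) {y : M} {x u v : α → M}
    (hyx : ∀ d ∈ l, y * x d * u d = v d * x d * y)
    (hu : ∀ d ∈ l, ∀ e ∈ l, d ≠ e → Commute (x d) (u e))
    (hv : ∀ d ∈ l, ∀ e ∈ l, d ≠ e → Commute (x d) (v e)) :
    y * (l.map x).prod * (l.map u).prod = (l.map v).prod * (l.map x).prod * y := by
  induction l with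
  | nil => simp
  | cons d l ih =>
    rw [nodup_cons] at hl
    have ih := ih hl.2 (fun d hd => hyx d (mem_cons_of_mem _ hd))
      (fun d hd e he => hu d (mem_cons_of_mem _ hd) e (mem_cons_of_mem _ he))
      (fun d hd e he => hv d (mem_cons_of_mem _ hd) e (mem_cons_of_mem _ he))
    have hcu : Commute (u d) (l.map x).prod := commute_prod_map fun e he =>
      (hu e (mem_cons_of_mem _ he) d mem_cons_self fun h => hl.1 (h ▸ he)).symm
    have hcv : Commute (x d) (l.map v).prod := commute_prod_map fun e he =>
      hv d mem_cons_self e (mem_cons_of_mem _ he) fun h => hl.1 (h ▸ he)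
    simp only [map_cons, prod_cons]
    calc y * (x d * (l.map x).prod) * (u d * (l.map u).prod)
        = y * x d * ((l.map x).prod * u d) * (l.map u).prod := by simp only [mul_assoc]
      _ = (y * x d * u d) * (l.map x).prod * (l.map u).prod := by
          rw [← hcu.eq]; simp only [mul_assoc]
      _ = v d * x d * (y * (l.map x).prod * (l.map u).prod) := by
          rw [hyx d mem_cons_self]; simp only [mul_assoc]
      _ = v d * (x d * (l.map v).prod) * (l.map x).prod * y := by
          rw [ih]; simp only [mul_assoc]
      _ = v d * (l.map v).prod * (x d * (l.map x).prod) * y := by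
          rw [hcv.eq]; simp only [mul_assoc]

theorem prod_map_mul_prod_pairs [LinearOrder α] {l : List α} (hl : l.Pairwise (· < ·))
    {x : α → M} {u v : α × α → M}
    (hx : ∀ p ∈ l.pairs, x p.1 * x p.2 * u p = v p * x p.2 * x p.1)
    (hu : ∀ e ∈ l, ∀ p ∈ l.pairs, e ≠ p.1 → e ≠ p.2 → Commute (x e) (u p))
    (hv : ∀ e ∈ l, ∀ p ∈ l.pairs, e ≠ p.1 → e ≠ p.2 → Commute (x e) (v p)) :
    (l.map x).prod * (l.pairs.map u).prod =
      (l.pairs.map v).prod * (l.reverse.map x).prod := by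
  induction l with
  | nil => simp [pairs]
  | cons c l ih =>
    rw [pairwise_cons] at hl
    have hrow : ∀ d ∈ l, (c, d) ∈ (c :: l).pairs := fun d hd => by simp [pairs, hd]
    have htail : ∀ p ∈ l.pairs, p ∈ (c :: l).pairs := fun p hp => by simp [pairs, hp]
    have hne : ∀ d ∈ l, d ≠ c := fun d hd => (hl.1 d hd).ne'
    have ih := ih hl.2 (fun p hp => hx p (htail p hp))
      (fun e he p hp => hu e (mem_cons_of_mem _ he) p (htail p hp))
      (fun e he p hp => hv e (mem_cons_of_mem _ he) p (htail p hp))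
    have hmove := mul_prod_map_mul_prod_map (l := l) (y := x c) (x := x)
      (u := fun d => u (c, d)) (v := fun d => v (c, d)) (hl.2.imp fun h => ne_of_lt h)
      (fun d hd => hx _ (hrow d hd))
      (fun d hd e he hde => hu d (mem_cons_of_mem _ hd) _ (hrow e he) (hne d hd) hde)
      (fun d hd e he hde => hv d (mem_cons_of_mem _ hd) _ (hrow e he) (hne d hd) hde)
    have hcomm : Commute (x c) (l.pairs.map u).prod := commute_prod_map fun p hp => by
      have hp' := (mem_pairs_iff hl.2).1 hp
      exact hu c mem_cons_self p (htail p hp) (hne _ hp'.1).symm (hne _ hp'.2.1).symm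
    simp only [pairs, map_cons, prod_cons, map_append, map_map, prod_append, reverse_cons,
      map_nil, prod_nil, mul_one, Function.comp_def]
    calc x c * (l.map x).prod * ((l.map fun d => u (c, d)).prod * (l.pairs.map u).prod)
        = (l.map fun d => v (c, d)).prod * (l.map x).prod * (x c * (l.pairs.map u).prod) := by
          rw [← mul_assoc, hmove, mul_assoc]
      _ = (l.map fun d => v (c, d)).prod * ((l.map x).prod * (l.pairs.map u).prod) * x c := by
          rw [hcomm.eq]; simp only [mul_assoc]
      _ = _ := by rw [ih]; simp only [mul_assoc]

end Monoid

end List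

open List

/-- `R` satisfies the far-commutativity and tetrahedron relations on the indices in `s`. -/
structure IsTetrahedral {α M : Type*} [LinearOrder α] [Monoid M] (s : Set α)
    (R : α → α → α → M) : Prop where
  comm : ∀ a ∈ s, ∀ b ∈ s, ∀ c ∈ s, ∀ a' ∈ s, ∀ b' ∈ s, ∀ c' ∈ s, a < b → b < c →
    a' < b' → b' < c' → (({a, b, c} : Finset α) ∩ {a', b', c'}).card ≠ 2 →
    Commute (R a b c) (R a' b' c')
  tetra : ∀ a ∈ s, ∀ b ∈ s, ∀ c ∈ s, ∀ d ∈ s, a < b → b < c → c < d →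
    R a b c * R a b d * R a c d * R b c d = R b c d * R a c d * R a b d * R a b c

namespace IsTetrahedral

variable {α M : Type*} [LinearOrder α] [Monoid M] {s : Set α} {R : α → α → α → M}

theorem commute (hR : IsTetrahedral s R) {a b c a' b' c' : α}
    (ha : a ∈ s) (hb : b ∈ s) (hc : c ∈ s) (ha' : a' ∈ s) (hb' : b' ∈ s) (hc' : c' ∈ s)
    (hab : a < b) (hbc : b < c) (hab' : a' < b') (hbc' : b' < c')
    (h : ∀ p q, p < q → (p = a ∨ p = b ∨ p = c) → (q = a ∨ q = b ∨ q = c) →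
      (p = a' ∨ p = b' ∨ p = c') → (q = a' ∨ q = b' ∨ q = c') → False) :
    Commute (R a b c) (R a' b' c') := by
  refine hR.comm a ha b hb c hc a' ha' b' hb' c' hc' hab hbc hab' hbc' fun hcard => ?_
  obtain ⟨p, q, hpq, hset⟩ := Finset.card_eq_two.1 hcard
  have hp : p ∈ ({a, b, c} : Finset α) ∩ {a', b', c'} := by simp [hset]
  have hq : q ∈ ({a, b, c} : Finset α) ∩ {a', b', c'} := by simp [hset]
  simp only [Finset.mem_inter, Finset.mem_insert, Finset.mem_singleton] at hp hq
  rcases hpq.lt_or_gt with hlt | hlt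
  · exact h p q hlt hp.1 hq.1 hp.2 hq.2
  · exact h q p hlt hq.1 hp.1 hq.2 hp.2

/-- Moving the factors `R k c d` through the lexicographic product of the `R m b c` carries the
factors `R m k c` to the far end, in reverse order. -/
theorem prod_row_mul (hR : IsTetrahedral s R) {m k : α} {l : List α}
    (hl : (m :: k :: l).Pairwise (· < ·)) (hs : ∀ a ∈ m :: k :: l, a ∈ s) :
    (l.map (R m k)).prod * ((l.pairs.map fun p => R m p.1 p.2).prod *
        (l.pairs.map fun p => R k p.1 p.2).prod) =
      (l.pairs.map fun p => R k p.1 p.2).prod * (l.pairs.map fun p => R m p.1 p.2).prod *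
        (l.reverse.map (R m k)).prod := by
  simp only [pairwise_cons, mem_cons, forall_eq_or_imp] at hl hs
  obtain ⟨⟨hmk, hm⟩, hk, hl⟩ := hl
  obtain ⟨hms, hks, hs⟩ := hs
  have hmem : ∀ p ∈ l.pairs, p.1 ∈ l ∧ p.2 ∈ l ∧ p.1 < p.2 := fun p hp => (mem_pairs_iff hl).1 hp
  have hzy : ∀ p ∈ l.pairs, ∀ q ∈ l.pairs, p ≠ q →
      Commute (R k p.1 p.2) (R m q.1 q.2) := by
    intro p hp q hq hpq
    obtain ⟨hp1, hp2, hp⟩ := hmem p hp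
    obtain ⟨hq1, hq2, hq⟩ := hmem q hq
    refine hR.commute hks (hs _ hp1) (hs _ hp2) hms (hs _ hq1) (hs _ hq2)
      (hk _ hp1) hp (hm _ hq1) hq ?_
    have := hk _ hp1; have := hk _ hp2; have := hk _ hq1; have := hk _ hq2
    rcases p with ⟨a, b⟩; rcases q with ⟨c, d⟩
    simp only [ne_eq, Prod.mk.injEq] at *
    grind
  have hxy : ∀ e ∈ l, ∀ p ∈ l.pairs, e ≠ p.1 → e ≠ p.2 →
      Commute (R m k e) (R m p.1 p.2) := by
    intro e he p hp h1 h2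
    obtain ⟨hp1, hp2, hp⟩ := hmem p hp
    refine hR.commute hms hks (hs _ he) hms (hs _ hp1) (hs _ hp2) hmk (hk _ he) (hm _ hp1) hp ?_
    have := hk _ hp1; have := hk _ hp2; have := hk _ he
    grind
  have hxz : ∀ e ∈ l, ∀ p ∈ l.pairs, e ≠ p.1 → e ≠ p.2 →
      Commute (R m k e) (R k p.1 p.2) := by
    intro e he p hp h1 h2
    obtain ⟨hp1, hp2, hp⟩ := hmem p hp
    refine hR.commute hms hks (hs _ he) hks (hs _ hp1) (hs _ hp2) hmk (hk _ he) (hk _ hp1) hp ?_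
    have := hk _ hp1; have := hk _ hp2; have := hk _ he
    grind
  rw [← prod_map_mul_of_commute (nodup_pairs hl) hzy,
    ← prod_map_mul_of_commute (nodup_pairs hl) fun p hp q hq hpq => (hzy q hq p hp hpq.symm).symm]
  refine prod_map_mul_prod_pairs hl (fun p hp => ?_)
    (fun e he p hp h1 h2 => (hxy e he p hp h1 h2).mul_right (hxz e he p hp h1 h2))
    (fun e he p hp h1 h2 => (hxz e he p hp h1 h2).mul_right (hxy e he p hp h1 h2))
  obtain ⟨hp1, hp2, hp⟩ := hmem p hp
  rw [← mul_assoc]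
  exact hR.tetra m hms k hks _ (hs _ hp1) _ (hs _ hp2) hmk (hk _ hp1) hp

/-- Conjugation by the lexicographic product over triples reverses the lexicographic product of
the `R m b c` over pairs. -/
theorem prod_pairs_mul_prod_triples (hR : IsTetrahedral s R) {m : α} {l : List α}
    (hl : (m :: l).Pairwise (· < ·)) (hs : ∀ a ∈ m :: l, a ∈ s) :
    (l.pairs.map fun p => R m p.1 p.2).prod *
        (l.triples.map fun t => R t.1 t.2.1 t.2.2).prod =
      (l.triples.map fun t => R t.1 t.2.1 t.2.2).prod *
        (l.pairs.reverse.map fun p => R m p.1 p.2).prod := by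
  induction l with
  | nil => simp [pairs, triples]
  | cons k l ih =>
    have hrow := hR.prod_row_mul hl hs
    simp only [pairwise_cons, mem_cons, forall_eq_or_imp] at hl hs ih
    obtain ⟨⟨hmk, hm⟩, hk, hl⟩ := hl
    obtain ⟨hms, hks, hs⟩ := hs
    have ih := ih ⟨hm, hl⟩ ⟨hms, hs⟩
    have hcomm : Commute (l.reverse.map (R m k)).prod
        (l.triples.map fun t => R t.1 t.2.1 t.2.2).prod := by
      refine commute_prod_map fun t ht => (commute_prod_map fun e he => ?_).symm
      rw [mem_reverse] at he
      obtain ⟨ht1, ht2, ht3, h12, h23⟩ := (mem_triples_iff hl).1 ht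
      refine (hR.commute hms hks (hs _ he) (hs _ ht1) (hs _ ht2) (hs _ ht3) hmk (hk _ he)
        h12 h23 ?_).symm
      have := hk _ ht1
      grind
    simp only [pairs, triples, map_append, map_map, prod_append, reverse_append,
      Function.comp_def, ← map_reverse]
    rw [mul_assoc, ← mul_assoc (l.pairs.map fun p => R m p.1 p.2).prod, ← mul_assoc, hrow,
      mul_assoc, hcomm.eq, ← mul_assoc, mul_assoc _ _ (l.triples.map _).prod, ih]
    simp only [mul_assoc]

theorem prod_triples_eq_prod_reverse (hR : IsTetrahedral s R) {l : List α}
    (hl : l.Pairwise (· < ·)) (hs : ∀ a ∈ l, a ∈ s) :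
    (l.triples.map fun t => R t.1 t.2.1 t.2.2).prod =
      (l.triples.reverse.map fun t => R t.1 t.2.1 t.2.2).prod := by
  induction l with
  | nil => simp [triples]
  | cons m l ih =>
    have h := hR.prod_pairs_mul_prod_triples hl hs
    have ih := ih (pairwise_cons.1 hl).2 fun a ha => hs a (mem_cons_of_mem _ ha)
    simp only [triples, map_append, map_map, prod_append, reverse_append, Function.comp_def,
      ← map_reverse]
    rw [h, ih]

end IsTetrahedral

theorem tripleList_eq_triples (N : ℕ) : tripleList N = (List.range' 1 N).triples := by
  have hl : (List.range' 1 N).Pairwise (· < ·) := pairwise_lt_range'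
  have hsorted : (tripleList N).Pairwise (Prod.Lex (· < ·) (Prod.Lex (· < ·) (· < ·))) := by
    refine Pairwise.filter _ ?_
    refine pairwise_flatMap.2 ⟨fun a _ => pairwise_flatMap.2 ⟨fun b _ => pairwise_map.2 ?_, ?_⟩, ?_⟩
    · exact pairwise_lt_range.imp fun h => .right _ (.right _ h)
    · refine pairwise_lt_range.imp fun h => ?_
      simp only [mem_map]
      rintro _ ⟨c, -, rfl⟩ _ ⟨d, -, rfl⟩
      exact .right _ (.left _ _ h)
    · refine pairwise_lt_range.imp fun h => ?_
      simp only [mem_flatMap, mem_map]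
      rintro _ ⟨b, -, c, -, rfl⟩ _ ⟨d, -, e, -, rfl⟩
      exact .left _ _ h
  have hirr : ∀ t : ℕ × ℕ × ℕ, ¬ Prod.Lex (· < ·) (Prod.Lex (· < ·) (· < ·)) t t := fun t h => by
    simp [Prod.lex_def] at h
  have hnodup : ∀ l : List (ℕ × ℕ × ℕ),
      l.Pairwise (Prod.Lex (· < ·) (Prod.Lex (· < ·) (· < ·))) → l.Nodup := fun l h =>
    h.imp fun {p q} hpq => by
      rintro rfl
      exact hirr p hpq
  refine Perm.eq_of_pairwise ?_ hsorted (pairwise_triples hl) ?_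
  · rintro ⟨a, b, c⟩ ⟨d, e, f⟩ - - h1 h2
    simp only [Prod.lex_def] at h1 h2
    grind
  · refine (perm_ext_iff_of_nodup (hnodup _ hsorted) (hnodup _ (pairwise_triples hl))).2 ?_
    rintro ⟨a, b, c⟩
    simp only [mem_triples_iff hl, tripleList, mem_filter, mem_flatMap, mem_map, mem_range,
      mem_range'_1, decide_eq_true_eq, Prod.mk.injEq]
    constructor
    · rintro ⟨-, h⟩
      omega
    · intro h
      exact ⟨⟨a, by omega, b, by omega, c, by omega, rfl, rfl, rfl⟩, by omega⟩

/-- In the group `B(3,N)` (generators `R_{abc}`, `1 ≤ a < b < c ≤ N`, commuting unless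
their index sets share exactly two elements and satisfying the tetrahedron relations),
the lexicographically ordered product of all generators equals the reversely ordered
product. -/
theorem word_eq_reverse_word_B3 {G : Type*} [Group G] (N : ℕ) (R : ℕ → ℕ → ℕ → G)
    (hcomm : ∀ a b c a' b' c' : ℕ, 1 ≤ a → a < b → b < c → c ≤ N →
      1 ≤ a' → a' < b' → b' < c' → c' ≤ N →
      (({a, b, c} : Finset ℕ) ∩ {a', b', c'}).card ≠ 2 →
      R a b c * R a' b' c' = R a' b' c' * R a b c)
    (htetra : ∀ a b c d : ℕ, 1 ≤ a → a < b → b < c → c < d → d ≤ N →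
      R a b c * R a b d * R a c d * R b c d = R b c d * R a c d * R a b d * R a b c) :
    ((tripleList N).map fun t => R t.1 t.2.1 t.2.2).prod =
      ((tripleList N).reverse.map fun t => R t.1 t.2.1 t.2.2).prod := by
  have hR : IsTetrahedral (Set.Icc 1 N) R :=
    { comm := fun a ha b _ c hc a' ha' b' _ c' hc' hab hbc hab' hbc' h =>
        hcomm a b c a' b' c' ha.1 hab hbc hc.2 ha'.1 hab' hbc' hc'.2 h
      tetra := fun a ha b _ c _ d hd hab hbc hcd => htetra a b c d ha.1 hab hbc hcd hd.2 }
  rw [tripleList_eq_triples]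
  refine hR.prod_triples_eq_prod_reverse pairwise_lt_range' fun a ha => ?_
  rw [mem_range'_1] at ha
  exact ⟨ha.1, by omega⟩
end

section
/- Let T_N be the quantum torus algebra with generators Z_{ij} (1 ≤ i < j ≤ N) satisfying Z_{ij} Z_{i'j'} = q^{B_{(i,j),(i',j')}} Z_{i'j'} Z_{ij}, where B is the skew-symmetric incidence matrix of the triangular quiver Q_N. Then the map ρ determined by ρ(Z_{ij}) = Z_{j−i, N+1−i} extends to a well-defined algebra automorphism of T_N of order 3 (ρ∘ρ∘ρ = id). -/
/-- Entry `B_{v,w}` of the skew-symmetric incidence matrix of the triangular quiver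
`Q_N`: edges go `(i,j)→(i,j+1)`, `(i,j)→(i+1,j)` and `(i+1,j+1)→(i,j)`. -/
def Bfun (v w : ℕ × ℕ) : ℤ :=
  if (w = (v.1, v.2 + 1) ∨ w = (v.1 + 1, v.2) ∨ v = (w.1 + 1, w.2 + 1)) then 1
  else if (v = (w.1, w.2 + 1) ∨ v = (w.1 + 1, w.2) ∨ w = (v.1 + 1, v.2 + 1)) then -1
  else 0

/-- Vertices of the quiver `Q_N`: pairs `(i,j)` with `1 ≤ i < j ≤ N`. -/
def QIdx (N : ℕ) := {p : ℕ × ℕ // 1 ≤ p.1 ∧ p.1 < p.2 ∧ p.2 ≤ N}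

/-- The defining relations of the quantum torus `T_N`:
`Z_{ij} Z_{i'j'} = q^{B_{(i,j),(i',j')}} Z_{i'j'} Z_{ij}` with `q = RatFunc.X`. -/
noncomputable def torusRel (N : ℕ) :
    FreeAlgebra (RatFunc ℚ) (QIdx N) → FreeAlgebra (RatFunc ℚ) (QIdx N) → Prop :=
  fun x y => ∃ v w : QIdx N,
    x = FreeAlgebra.ι (RatFunc ℚ) v * FreeAlgebra.ι (RatFunc ℚ) w ∧
    y = ((RatFunc.X : RatFunc ℚ) ^ (Bfun v.val w.val)) •
      (FreeAlgebra.ι (RatFunc ℚ) w * FreeAlgebra.ι (RatFunc ℚ) v)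

/-- The quantum torus algebra `T_N` associated to the quiver `Q_N`. -/
noncomputable def QTorus (N : ℕ) := RingQuot (torusRel N)

noncomputable instance (N : ℕ) : Ring (QTorus N) := by unfold QTorus; infer_instance
noncomputable instance (N : ℕ) : Algebra (RatFunc ℚ) (QTorus N) := by
  unfold QTorus; infer_instance

/-- The generator `Z_{ij}` of `T_N`. -/
noncomputable def Zgen (N : ℕ) (v : QIdx N) : QTorus N :=
  RingQuot.mkAlgHom (RatFunc ℚ) (torusRel N) (FreeAlgebra.ι (RatFunc ℚ) v)

/-- The rotation `(i, j) ↦ (j - i, N + 1 - i)` of the vertices of `Q_N`. -/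
def QIdx.rotate {N : ℕ} (v : QIdx N) : QIdx N :=
  ⟨(v.val.2 - v.val.1, N + 1 - v.val.1), by have := v.property; omega⟩

theorem QIdx.rotate_rotate_rotate {N : ℕ} (v : QIdx N) : v.rotate.rotate.rotate = v := by
  obtain ⟨⟨i, j⟩, h⟩ := v
  apply Subtype.ext
  simp only [QIdx.rotate, Prod.mk.injEq] at h ⊢
  omega

theorem Bfun_rotate {N : ℕ} (v w : QIdx N) :
    Bfun v.rotate.val w.rotate.val = Bfun v.val w.val := by
  obtain ⟨⟨i, j⟩, hv⟩ := v
  obtain ⟨⟨k, l⟩, hw⟩ := w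
  simp only [QIdx.rotate, Bfun, Prod.mk.injEq] at hv hw ⊢
  split_ifs <;> first | rfl | omega

namespace QTorus

/-- The quotient map from the free algebra onto `T_N`. -/
noncomputable def mk (N : ℕ) : FreeAlgebra (RatFunc ℚ) (QIdx N) →ₐ[RatFunc ℚ] QTorus N :=
  RingQuot.mkAlgHom (RatFunc ℚ) (torusRel N)

theorem Zgen_mul_Zgen {N : ℕ} (v w : QIdx N) :
    Zgen N v * Zgen N w =
      ((RatFunc.X : RatFunc ℚ) ^ Bfun v.val w.val) • (Zgen N w * Zgen N v) := by
  have h : mk N (FreeAlgebra.ι (RatFunc ℚ) v * FreeAlgebra.ι (RatFunc ℚ) w) =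
      mk N (((RatFunc.X : RatFunc ℚ) ^ Bfun v.val w.val) •
        (FreeAlgebra.ι (RatFunc ℚ) w * FreeAlgebra.ι (RatFunc ℚ) v)) :=
    RingQuot.mkAlgHom_rel (RatFunc ℚ) ⟨v, w, rfl, rfl⟩
  rwa [map_smul, map_mul, map_mul] at h

variable {A : Type*} [Ring A] [Algebra (RatFunc ℚ) A]

/-- The universal property of `T_N`: elements satisfying the defining relations determine an
algebra homomorphism. -/
noncomputable def lift {N : ℕ} (f : QIdx N → A)
    (hf : ∀ v w, f v * f w = ((RatFunc.X : RatFunc ℚ) ^ Bfun v.val w.val) • (f w * f v)) :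
    QTorus N →ₐ[RatFunc ℚ] A :=
  RingQuot.liftAlgHom (RatFunc ℚ) (s := torusRel N) ⟨FreeAlgebra.lift (RatFunc ℚ) f, by
    rintro _ _ ⟨v, w, rfl, rfl⟩
    simpa using hf v w⟩

theorem lift_Zgen {N : ℕ} (f : QIdx N → A)
    (hf : ∀ v w, f v * f w = ((RatFunc.X : RatFunc ℚ) ^ Bfun v.val w.val) • (f w * f v))
    (v : QIdx N) : lift f hf (Zgen N v) = f v :=
  (RingQuot.liftAlgHom_mkAlgHom_apply (RatFunc ℚ) _ _ _).trans (FreeAlgebra.lift_ι_apply _ _)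

theorem algHom_ext {N : ℕ} {f g : QTorus N →ₐ[RatFunc ℚ] A}
    (h : ∀ v, f (Zgen N v) = g (Zgen N v)) : f = g := by
  have key : f.comp (mk N) = g.comp (mk N) := FreeAlgebra.hom_ext (funext h)
  exact RingQuot.ringQuot_ext' (RatFunc ℚ) f g key

/-- The endomorphism of `T_N` induced by the rotation of `Q_N`. -/
noncomputable def rotation (N : ℕ) : QTorus N →ₐ[RatFunc ℚ] QTorus N :=
  lift (fun v => Zgen N v.rotate) fun v w => by
    rw [Zgen_mul_Zgen, Bfun_rotate]

theorem rotation_Zgen {N : ℕ} (v : QIdx N) : rotation N (Zgen N v) = Zgen N v.rotate :=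
  lift_Zgen _ _ v

theorem rotation_comp_rotation_comp_rotation (N : ℕ) :
    (rotation N).comp ((rotation N).comp (rotation N)) = AlgHom.id (RatFunc ℚ) (QTorus N) :=
  algHom_ext fun v => by
    simp only [AlgHom.comp_apply, rotation_Zgen, QIdx.rotate_rotate_rotate, AlgHom.id_apply]

end QTorus

/-- The assignment `ρ(Z_{ij}) = Z_{j-i, N+1-i}` extends to a well-defined algebra
automorphism of the quantum torus `T_N` of order three. -/
theorem exists_rotation_automorphism (N : ℕ) (hN : 2 ≤ N) :
    ∃ ρ : QTorus N ≃ₐ[RatFunc ℚ] QTorus N,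
      (∀ (i j : ℕ) (h : 1 ≤ i ∧ i < j ∧ j ≤ N),
        ρ (Zgen N ⟨(i, j), h⟩) = Zgen N ⟨(j - i, N + 1 - i), by omega⟩) ∧
      (∀ x : QTorus N, ρ (ρ (ρ x)) = x) := by
  refine ⟨AlgEquiv.ofAlgHom (QTorus.rotation N)
    ((QTorus.rotation N).comp (QTorus.rotation N))
    (QTorus.rotation_comp_rotation_comp_rotation N)
    (QTorus.rotation_comp_rotation_comp_rotation N), fun i j h => ?_, fun x => ?_⟩
  · exact QTorus.rotation_Zgen _
  · exact DFunLike.congr_fun (QTorus.rotation_comp_rotation_comp_rotation N) x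
end
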